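/- (Necessary optimality condition for the isoperimetric problem; specialization of Theorem 6 to the time scale T = ℝ.) Let x̂ be a normal extremizer of the isoperimetric problem: extremize L(x) = H(∫_a^b f_1(t,x,x') dt, …, ∫_a^b f_m(t,x,x') dt) subject to x(a) = x_a, x(b) = x_b and the constraint K(x) = P(∫_a^b g_1(t,x,x') dt, …, ∫_a^b g_p(t,x,x') dt) = d. Then there exist real numbers λ and c such that for all t ∈ [a,b], Σ_{i=1}^{m} H_i' · ( f_{iv}(t, x̂(t), x̂'(t)) − ∫_a^t f_{iy}(τ, x̂(τ), x̂'(τ)) dτ ) − λ · Σ_{j=1}^{p} P_j' · ( g_{jv}(t, x̂(t), x̂'(t)) − ∫_a^t g_{jy}(τ, x̂(τ), x̂'(τ)) dτ ) = c, where H_i' and P_j' denote the partial derivatives of H and P evaluated at the vectors of integrals computed along x̂. -/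

import Mathlib

open Set intervalIntegral

/-- Sup norm of `g` over the interval `[a, b]`. -/
noncomputable def supIcc (a b : ℝ) (g : ℝ → ℝ) : ℝ :=
  ⨆ t : Icc a b, |g t.1|

open Filter Topology Asymptotics

/-- A function on `ι → ℝ` with continuous partial derivatives is strictly differentiable. -/
theorem hasStrictFDerivAt_of_continuous_partials {ι : Type*} [Fintype ι] [DecidableEq ι]
    {F : (ι → ℝ) → ℝ} {F' : ι → (ι → ℝ) → ℝ}
    (hF : ∀ i z, HasDerivAt (fun s => F (Function.update z i s)) (F' i z) (z i))
    (hF' : ∀ i, Continuous (F' i)) (z : ι → ℝ) :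
    HasStrictFDerivAt F
      (∑ i, F' i z • (ContinuousLinearMap.proj i : (ι → ℝ) →L[ℝ] ℝ)) z := by
  have key : ∀ s : Finset ι,
      (fun q : (ι → ℝ) × (ι → ℝ) =>
        F (s.piecewise q.1 q.2) - F q.2 - ∑ i ∈ s, F' i z * (q.1 i - q.2 i))
      =o[𝓝 (z, z)] fun q => q.1 - q.2 := by
    intro s
    induction s using Finset.induction_on with
    | empty => simp
    | insert i s hi ih =>
      have step : (fun q : (ι → ℝ) × (ι → ℝ) =>
          F ((insert i s).piecewise q.1 q.2) - F (s.piecewise q.1 q.2)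
            - F' i z * (q.1 i - q.2 i)) =o[𝓝 (z, z)] fun q => q.1 - q.2 := by
        rw [isLittleO_iff]
        intro c hc
        obtain ⟨r, hr, hrc⟩ := Metric.continuousAt_iff.1 (hF' i).continuousAt c hc
        have hball : ∀ᶠ q in 𝓝 (z, z), q ∈ Metric.ball z r ×ˢ Metric.ball z r :=
          prod_mem_nhds (Metric.ball_mem_nhds z hr) (Metric.ball_mem_nhds z hr)
        filter_upwards [hball] with q hq
        obtain ⟨hq1, hq2⟩ := hq
        rw [Metric.mem_ball, dist_pi_lt_iff hr] at hq1 hq2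
        set u := s.piecewise q.1 q.2 with hu
        have hder : ∀ σ ∈ uIcc (q.2 i) (q.1 i), HasDerivWithinAt
            (fun σ => F (Function.update u i σ) - F' i z * σ)
            (F' i (Function.update u i σ) - F' i z) (uIcc (q.2 i) (q.1 i)) σ := by
          intro σ _
          have h := hF i (Function.update u i σ)
          simp only [Function.update_idem, Function.update_self] at h
          have h' := (h.sub ((hasDerivAt_id σ).const_mul (F' i z))).hasDerivWithinAt
            (s := uIcc (q.2 i) (q.1 i))
          rwa [mul_one] at h'
        have hbd : ∀ σ ∈ uIcc (q.2 i) (q.1 i),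
            ‖F' i (Function.update u i σ) - F' i z‖ ≤ c := by
          intro σ hσ
          rw [← dist_eq_norm]
          refine (hrc ?_).le
          rw [dist_pi_lt_iff hr]
          intro j
          by_cases hj : j = i
          · subst hj
            rw [Function.update_self]
            exact (convex_ball (z j) r).ordConnected.uIcc_subset (hq2 j) (hq1 j) hσ
          · rw [Function.update_of_ne hj, hu]
            by_cases hjs : j ∈ s
            · simpa [hjs] using hq1 j
            · simpa [hjs] using hq2 j
        have hmv := (convex_uIcc (q.2 i) (q.1 i)).norm_image_sub_le_of_norm_hasDerivWithin_le
          hder hbd left_mem_uIcc right_mem_uIcc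
        have h1 : (insert i s).piecewise q.1 q.2 = Function.update u i (q.1 i) :=
          Finset.piecewise_insert ..
        have h2 : Function.update u i (q.2 i) = u := by
          rw [Function.update_eq_self_iff, hu, Finset.piecewise_eq_of_notMem _ _ _ hi]
        rw [h2] at hmv
        rw [h1]
        calc _ = ‖F (Function.update u i (q.1 i)) - F' i z * q.1 i - (F u - F' i z * q.2 i)‖ := by
              congr 1; ring
          _ ≤ c * ‖q.1 i - q.2 i‖ := hmv
          _ ≤ c * ‖q.1 - q.2‖ := by
              gcongr
              exact norm_le_pi_norm (q.1 - q.2) i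
      refine (step.add ih).congr_left fun q => ?_
      rw [Finset.sum_insert hi]
      ring
  rw [hasStrictFDerivAt_iff_isLittleO]
  refine (key Finset.univ).congr_left fun q => ?_
  simp

/-- **Du Bois-Reymond lemma**: a continuous function orthogonal to all continuous functions of
zero mean is constant. -/
theorem exists_eq_const_of_integral_mul_eq_zero {a b : ℝ} (hab : a < b) {Φ : ℝ → ℝ}
    (hΦ : ContinuousOn Φ (Icc a b))
    (h : ∀ φ : ℝ → ℝ, Continuous φ → ∫ t in a..b, φ t = 0 → ∫ t in a..b, Φ t * φ t = 0) :
    ∃ k, ∀ t ∈ Icc a b, Φ t = k := by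
  set E : ℝ → ℝ := IccExtend hab.le ((Icc a b).domRestrict Φ) with hE
  have hEc : Continuous E := (continuousOn_iff_continuous_domRestrict.1 hΦ).Icc_extend'
  have hEΦ : ∀ t ∈ Icc a b, E t = Φ t := fun t ht => IccExtend_of_mem _ _ ht
  set k := (∫ t in a..b, E t) / (b - a) with hk
  have hba : b - a ≠ 0 := (sub_pos.2 hab).ne'
  have hφc : Continuous fun t => E t - k := hEc.sub continuous_const
  have hφ0 : ∫ t in a..b, (E t - k) = 0 := by
    rw [integral_sub (hEc.intervalIntegrable _ _) intervalIntegrable_const, integral_const,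
      smul_eq_mul, hk, mul_div_cancel₀ _ hba, sub_self]
  have h0 : ∫ t in a..b, (E t - k) ^ 2 = 0 := by
    have h1 : ∫ t in a..b, (E t - k) ^ 2 = ∫ t in a..b, (Φ t * (E t - k) - k * (E t - k)) := by
      refine integral_congr fun t ht => ?_
      rw [uIcc_of_le hab.le] at ht
      simp only [← hEΦ t ht]
      ring
    have hint : IntervalIntegrable (fun t => Φ t * (E t - k)) MeasureTheory.volume a b :=
      (hΦ.mul hφc.continuousOn).intervalIntegrable_of_Icc hab.le
    rw [h1, integral_sub hint ((hφc.intervalIntegrable _ _).const_mul k), h _ hφc hφ0,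
      integral_const_mul, hφ0, mul_zero, sub_self]
  refine ⟨k, fun t ht => ?_⟩
  by_contra hne
  refine (integral_pos hab (hφc.pow 2).continuousOn (fun _ _ => sq_nonneg _) ⟨t, ht, ?_⟩).ne' h0
  have hne' : E t - k ≠ 0 := by rwa [hEΦ t ht, sub_ne_zero]
  exact sq_pos_of_ne_zero hne'

theorem hasDerivAt_integral_variation {a b : ℝ} {f fy fv : ℝ → ℝ → ℝ → ℝ}
    (hf : Continuous fun q : ℝ × ℝ × ℝ => f q.1 q.2.1 q.2.2)
    (hfyc : Continuous fun q : ℝ × ℝ × ℝ => fy q.1 q.2.1 q.2.2)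
    (hfvc : Continuous fun q : ℝ × ℝ × ℝ => fv q.1 q.2.1 q.2.2)
    (hfy : ∀ t y v, HasDerivAt (fun y' => f t y' v) (fy t y v) y)
    (hfv : ∀ t y v, HasDerivAt (fun v' => f t y v') (fv t y v) v)
    {x x' η φ : ℝ → ℝ} (hx : Continuous x) (hx' : Continuous x')
    (hη : Continuous η) (hφ : Continuous φ) (s₀ : ℝ) :
    HasDerivAt (fun s => ∫ t in a..b, f t (x t + s * η t) (x' t + s * φ t))
      (∫ t in a..b, (fy t (x t + s₀ * η t) (x' t + s₀ * φ t) * η t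
        + fv t (x t + s₀ * η t) (x' t + s₀ * φ t) * φ t)) s₀ := by
  have hder : ∀ t s, HasDerivAt (fun s => f t (x t + s * η t) (x' t + s * φ t))
      (fy t (x t + s * η t) (x' t + s * φ t) * η t
        + fv t (x t + s * η t) (x' t + s * φ t) * φ t) s := by
    intro t s
    have hjoint := hasStrictFDerivAt_uncurry_coprod (𝕜 := ℝ)
      (u := (x t + s * η t, x' t + s * φ t)) (f := f t)
      (f₁ := fun y v => ContinuousLinearMap.toSpanSingleton ℝ (fy t y v))
      (f₂ := fun y v => ContinuousLinearMap.toSpanSingleton ℝ (fv t y v))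
      (Eventually.of_forall fun q => (hfy t q.1 q.2).hasFDerivAt)
      (Eventually.of_forall fun q => (hfv t q.1 q.2).hasFDerivAt)
      ((ContinuousLinearMap.toSpanSingletonCLE (𝕜 := ℝ)).continuous.comp
        (hfyc.comp (continuous_const.prodMk continuous_id))).continuousAt
      ((ContinuousLinearMap.toSpanSingletonCLE (𝕜 := ℝ)).continuous.comp
        (hfvc.comp (continuous_const.prodMk continuous_id))).continuousAt
    have hcurve : HasDerivAt (fun s => (x t + s * η t, x' t + s * φ t)) (η t, φ t) s := by
      have h1 := ((hasDerivAt_id s).mul_const (η t)).const_add (x t)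
      have h2 := ((hasDerivAt_id s).mul_const (φ t)).const_add (x' t)
      rw [one_mul] at h1 h2
      exact h1.prodMk h2
    refine (hjoint.hasFDerivAt.comp_hasDerivAt s hcurve).congr_deriv ?_
    simp [Function.HasUncurry.uncurry, mul_comm]
  have hint : ∀ s, Continuous fun t => f t (x t + s * η t) (x' t + s * φ t) := fun s =>
    hf.comp (by fun_prop : Continuous fun t => (t, x t + s * η t, x' t + s * φ t))
  have hderc : Continuous fun q : ℝ × ℝ =>
      fy q.2 (x q.2 + q.1 * η q.2) (x' q.2 + q.1 * φ q.2) * η q.2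
        + fv q.2 (x q.2 + q.1 * η q.2) (x' q.2 + q.1 * φ q.2) * φ q.2 := by
    have hq : Continuous fun q : ℝ × ℝ =>
      (q.2, x q.2 + q.1 * η q.2, x' q.2 + q.1 * φ q.2) := by fun_prop
    exact ((hfyc.comp hq).mul (hη.comp continuous_snd)).add
      ((hfvc.comp hq).mul (hφ.comp continuous_snd))
  obtain ⟨C, hC⟩ := ((isCompact_closedBall s₀ 1).prod
    (isCompact_uIcc (a := a) (b := b))).exists_bound_of_continuousOn hderc.continuousOn
  refine (hasDerivAt_integral_of_dominated_loc_of_deriv_le (bound := fun _ => C)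
    (Metric.closedBall_mem_nhds s₀ one_pos)
    (Eventually.of_forall fun s => (hint s).aestronglyMeasurable)
    ((hint s₀).intervalIntegrable _ _)
    (hderc.comp (Continuous.prodMk_right s₀)).aestronglyMeasurable
    (Eventually.of_forall fun t ht s hs => hC (s, t) ⟨hs, uIoc_subset_uIcc ht⟩)
    intervalIntegrable_const (Eventually.of_forall fun t _ s _ => hder t s)).2

theorem hasStrictFDerivAt_integral_variation_of_continuous {a b : ℝ} {f fy fv : ℝ → ℝ → ℝ → ℝ}
    (hf : Continuous fun q : ℝ × ℝ × ℝ => f q.1 q.2.1 q.2.2)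
    (hfyc : Continuous fun q : ℝ × ℝ × ℝ => fy q.1 q.2.1 q.2.2)
    (hfvc : Continuous fun q : ℝ × ℝ × ℝ => fv q.1 q.2.1 q.2.2)
    (hfy : ∀ t y v, HasDerivAt (fun y' => f t y' v) (fy t y v) y)
    (hfv : ∀ t y v, HasDerivAt (fun v' => f t y v') (fv t y v) v)
    {x x' η₁ φ₁ η₂ φ₂ : ℝ → ℝ} (hx : Continuous x) (hx' : Continuous x')
    (hη₁ : Continuous η₁) (hφ₁ : Continuous φ₁) (hη₂ : Continuous η₂) (hφ₂ : Continuous φ₂) :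
    HasStrictFDerivAt (fun e : ℝ × ℝ => ∫ t in a..b,
        f t (x t + (e.1 * η₁ t + e.2 * η₂ t)) (x' t + (e.1 * φ₁ t + e.2 * φ₂ t)))
      ((ContinuousLinearMap.toSpanSingleton ℝ
          (∫ t in a..b, (fy t (x t) (x' t) * η₁ t + fv t (x t) (x' t) * φ₁ t))).coprod
        (ContinuousLinearMap.toSpanSingleton ℝ
          (∫ t in a..b, (fy t (x t) (x' t) * η₂ t + fv t (x t) (x' t) * φ₂ t)))) 0 := by
  set D : (ℝ → ℝ) → (ℝ → ℝ) → ℝ → ℝ → ℝ := fun η φ e₁ e₂ => ∫ t in a..b,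
    (fy t (x t + (e₁ * η₁ t + e₂ * η₂ t)) (x' t + (e₁ * φ₁ t + e₂ * φ₂ t)) * η t
      + fv t (x t + (e₁ * η₁ t + e₂ * η₂ t)) (x' t + (e₁ * φ₁ t + e₂ * φ₂ t)) * φ t) with hD
  have hDc : ∀ η φ : ℝ → ℝ, Continuous η → Continuous φ →
      Continuous fun e : ℝ × ℝ => D η φ e.1 e.2 := by
    intro η φ hη hφ
    refine continuous_parametric_intervalIntegral_of_continuous' ?_ a b
    have hq : Continuous fun q : (ℝ × ℝ) × ℝ => (q.2, x q.2 + (q.1.1 * η₁ q.2 + q.1.2 * η₂ q.2),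
        x' q.2 + (q.1.1 * φ₁ q.2 + q.1.2 * φ₂ q.2)) := by fun_prop
    exact ((hfyc.comp hq).mul (hη.comp continuous_snd)).add
      ((hfvc.comp hq).mul (hφ.comp continuous_snd))
  have h := hasStrictFDerivAt_uncurry_coprod (𝕜 := ℝ) (u := (0 : ℝ × ℝ))
    (f := fun e₁ e₂ : ℝ => ∫ t in a..b,
        f t (x t + (e₁ * η₁ t + e₂ * η₂ t)) (x' t + (e₁ * φ₁ t + e₂ * φ₂ t)))
    (f₁ := fun e₁ e₂ => ContinuousLinearMap.toSpanSingleton ℝ (D η₁ φ₁ e₁ e₂))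
    (f₂ := fun e₁ e₂ => ContinuousLinearMap.toSpanSingleton ℝ (D η₂ φ₂ e₁ e₂))
    (Eventually.of_forall fun q => ?_) (Eventually.of_forall fun q => ?_)
    ((ContinuousLinearMap.toSpanSingletonCLE (𝕜 := ℝ)).continuous.comp
      (hDc η₁ φ₁ hη₁ hφ₁)).continuousAt
    ((ContinuousLinearMap.toSpanSingletonCLE (𝕜 := ℝ)).continuous.comp
      (hDc η₂ φ₂ hη₂ hφ₂)).continuousAt
  · simpa [Function.HasUncurry.uncurry, hD] using h
  · have h := (hasDerivAt_integral_variation (a := a) (b := b) hf hfyc hfvc hfy hfv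
      (x := fun t => x t + q.2 * η₂ t) (x' := fun t => x' t + q.2 * φ₂ t)
      (by fun_prop) (by fun_prop) hη₁ hφ₁ q.1).hasFDerivAt
    simp only [add_assoc, add_comm (q.2 * _)] at h
    exact h
  · have h := (hasDerivAt_integral_variation (a := a) (b := b) hf hfyc hfvc hfy hfv
      (x := fun t => x t + q.1 * η₁ t) (x' := fun t => x' t + q.1 * φ₁ t)
      (by fun_prop) (by fun_prop) hη₂ hφ₂ q.2).hasFDerivAt
    simp only [add_assoc] at h
    exact h

/-- `f t y v` is continuous on `[a, b] × ℝ × ℝ`, with continuous partial derivatives `fy` and `fv`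
in `y` and `v`. -/
structure IsC1Lagrangian (a b : ℝ) (f fy fv : ℝ → ℝ → ℝ → ℝ) : Prop where
  continuousOn : ContinuousOn (fun q : ℝ × ℝ × ℝ => f q.1 q.2.1 q.2.2)
    (Icc a b ×ˢ (univ : Set (ℝ × ℝ)))
  continuousOn_fst : ContinuousOn (fun q : ℝ × ℝ × ℝ => fy q.1 q.2.1 q.2.2)
    (Icc a b ×ˢ (univ : Set (ℝ × ℝ)))
  continuousOn_snd : ContinuousOn (fun q : ℝ × ℝ × ℝ => fv q.1 q.2.1 q.2.2)
    (Icc a b ×ˢ (univ : Set (ℝ × ℝ)))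
  hasDerivAt_fst : ∀ t ∈ Icc a b, ∀ y v : ℝ, HasDerivAt (fun y' => f t y' v) (fy t y v) y
  hasDerivAt_snd : ∀ t ∈ Icc a b, ∀ y v : ℝ, HasDerivAt (fun v' => f t y v') (fv t y v) v

/-- The left-hand side of the integrated Euler–Lagrange equation along `x`. -/
noncomputable def integratedEulerLagrange (a : ℝ) (fy fv : ℝ → ℝ → ℝ → ℝ) (x x' : ℝ → ℝ)
    (t : ℝ) : ℝ :=
  fv t (x t) (x' t) - ∫ τ in a..t, fy τ (x τ) (x' τ)

theorem continuousOn_comp_curve {a b : ℝ} {f : ℝ → ℝ → ℝ → ℝ} {x x' : ℝ → ℝ}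
    (hf : ContinuousOn (fun q : ℝ × ℝ × ℝ => f q.1 q.2.1 q.2.2)
      (Icc a b ×ˢ (univ : Set (ℝ × ℝ))))
    (hx : ContinuousOn x (Icc a b)) (hx' : ContinuousOn x' (Icc a b)) :
    ContinuousOn (fun t => f t (x t) (x' t)) (Icc a b) :=
  hf.comp (continuousOn_id.prodMk (hx.prodMk hx')) fun _ ht => ⟨ht, mem_univ _⟩

theorem IsC1Lagrangian.continuousOn_integratedEulerLagrange {a b : ℝ} (hab : a < b)
    {f fy fv : ℝ → ℝ → ℝ → ℝ} (hf : IsC1Lagrangian a b f fy fv) {x x' : ℝ → ℝ}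
    (hx : ContinuousOn x (Icc a b)) (hx' : ContinuousOn x' (Icc a b)) :
    ContinuousOn (integratedEulerLagrange a fy fv x x') (Icc a b) := by
  refine (continuousOn_comp_curve hf.continuousOn_snd hx hx').sub ?_
  have h := (continuousOn_comp_curve hf.continuousOn_fst hx hx').intervalIntegrable_of_Icc
    (μ := MeasureTheory.volume) hab.le
  simpa only [uIcc_of_le hab.le] using continuousOn_primitive_interval' h left_mem_uIcc

/-- Integration by parts in the first variation. -/
theorem IsC1Lagrangian.integral_variation_eq {a b : ℝ} (hab : a < b)
    {f fy fv : ℝ → ℝ → ℝ → ℝ} (hf : IsC1Lagrangian a b f fy fv) {x x' φ : ℝ → ℝ}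
    (hx : ContinuousOn x (Icc a b)) (hx' : ContinuousOn x' (Icc a b))
    (hφ : Continuous φ) (hφ0 : ∫ t in a..b, φ t = 0) :
    ∫ t in a..b, (fy t (x t) (x' t) * (∫ τ in a..t, φ τ) + fv t (x t) (x' t) * φ t)
      = ∫ t in a..b, integratedEulerLagrange a fy fv x x' t * φ t := by
  have hy := continuousOn_comp_curve hf.continuousOn_fst hx hx'
  have hv := continuousOn_comp_curve hf.continuousOn_snd hx hx'
  have hyi := hy.intervalIntegrable_of_Icc (μ := MeasureTheory.volume) hab.le
  have hη : ∀ t, HasDerivAt (fun t => ∫ τ in a..t, φ τ) (φ t) t := fun t =>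
    (hφ.integral_hasStrictDerivAt a t).hasDerivAt
  have hηc : Continuous fun t => ∫ τ in a..t, φ τ :=
    continuous_iff_continuousAt.2 fun t => (hη t).continuousAt
  have hprim : ContinuousOn (fun t => ∫ τ in a..t, fy τ (x τ) (x' τ)) (uIcc a b) :=
    continuousOn_primitive_interval' hyi left_mem_uIcc
  have hparts := integral_mul_deriv_eq_deriv_mul_of_hasDerivAt (a := a) (b := b)
    (u' := fun t => fy t (x t) (x' t)) hprim hηc.continuousOn
    (fun t ht => ?_) (fun t _ => hη t) hyi (hφ.intervalIntegrable _ _)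
  · have hprim' : ContinuousOn (fun t => ∫ τ in a..t, fy τ (x τ) (x' τ)) (Icc a b) := by
      rwa [uIcc_of_le hab.le] at hprim
    simp only [integratedEulerLagrange, sub_mul]
    have hyη : IntervalIntegrable (fun t => fy t (x t) (x' t) * ∫ τ in a..t, φ τ)
        MeasureTheory.volume a b := (hy.mul hηc.continuousOn).intervalIntegrable_of_Icc hab.le
    have hvφ : IntervalIntegrable (fun t => fv t (x t) (x' t) * φ t)
        MeasureTheory.volume a b := (hv.mul hφ.continuousOn).intervalIntegrable_of_Icc hab.le
    have hpφ : IntervalIntegrable (fun t => (∫ τ in a..t, fy τ (x τ) (x' τ)) * φ t)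
        MeasureTheory.volume a b := (hprim'.mul hφ.continuousOn).intervalIntegrable_of_Icc hab.le
    rw [integral_add hyη hvφ, integral_sub hvφ hpφ, hparts, hφ0, integral_same]
    ring
  · rw [min_eq_left hab.le, max_eq_right hab.le] at ht
    have hnhds := Icc_mem_nhds ht.1 ht.2
    refine integral_hasDerivAt_right ?_ ?_ (hy.continuousAt hnhds)
    · exact (hy.mono (Icc_subset_Icc_right ht.2.le)).intervalIntegrable_of_Icc ht.1.le
    · exact (hy.mono Ioo_subset_Icc_self).stronglyMeasurableAtFilter isOpen_Ioo t ht

theorem IsC1Lagrangian.hasStrictFDerivAt_integral_variation {a b : ℝ} (hab : a < b)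
    {f fy fv : ℝ → ℝ → ℝ → ℝ} (hf : IsC1Lagrangian a b f fy fv) {x x' φ₁ φ₂ : ℝ → ℝ}
    (hx : ContinuousOn x (Icc a b)) (hx' : ContinuousOn x' (Icc a b))
    (hφ₁ : Continuous φ₁) (hφ₁0 : ∫ t in a..b, φ₁ t = 0)
    (hφ₂ : Continuous φ₂) (hφ₂0 : ∫ t in a..b, φ₂ t = 0) :
    HasStrictFDerivAt (fun e : ℝ × ℝ => ∫ t in a..b,
        f t (x t + (e.1 * (∫ τ in a..t, φ₁ τ) + e.2 * (∫ τ in a..t, φ₂ τ)))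
          (x' t + (e.1 * φ₁ t + e.2 * φ₂ t)))
      ((ContinuousLinearMap.toSpanSingleton ℝ
          (∫ t in a..b, integratedEulerLagrange a fy fv x x' t * φ₁ t)).coprod
        (ContinuousLinearMap.toSpanSingleton ℝ
          (∫ t in a..b, integratedEulerLagrange a fy fv x x' t * φ₂ t))) 0 := by
  rw [← hf.integral_variation_eq hab hx hx' hφ₁ hφ₁0,
    ← hf.integral_variation_eq hab hx hx' hφ₂ hφ₂0]
  set π : ℝ → ℝ := fun t => projIcc a b hab.le t with hπ
  have hπc : Continuous π := continuous_subtype_val.comp continuous_projIcc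
  have hπm : ∀ t, π t ∈ Icc a b := fun t => (projIcc a b hab.le t).2
  have hπe : ∀ t ∈ uIcc a b, π t = t := by
    intro t ht
    rw [uIcc_of_le hab.le] at ht
    simp [hπ, projIcc_of_mem hab.le ht]
  have hext : ∀ {h : ℝ → ℝ → ℝ → ℝ}, ContinuousOn (fun q : ℝ × ℝ × ℝ => h q.1 q.2.1 q.2.2)
      (Icc a b ×ˢ (univ : Set (ℝ × ℝ))) →
      Continuous fun q : ℝ × ℝ × ℝ => h (π q.1) q.2.1 q.2.2 := fun hh =>
    hh.comp_continuous ((hπc.comp continuous_fst).prodMk continuous_snd)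
      fun q => ⟨hπm q.1, mem_univ _⟩
  have hprim : ∀ {φ : ℝ → ℝ}, Continuous φ → Continuous fun t => ∫ τ in a..t, φ τ := fun hφ =>
    continuous_primitive (fun _ _ => hφ.intervalIntegrable _ _) a
  have h := hasStrictFDerivAt_integral_variation_of_continuous (a := a) (b := b)
    (hext hf.continuousOn) (hext hf.continuousOn_fst) (hext hf.continuousOn_snd)
    (fun t => hf.hasDerivAt_fst _ (hπm t)) (fun t => hf.hasDerivAt_snd _ (hπm t))
    (hx.comp_continuous hπc hπm) (hx'.comp_continuous hπc hπm)
    (hprim hφ₁) hφ₁ (hprim hφ₂) hφ₂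
  have hcongr : ∀ {u v : ℝ → ℝ}, (∀ t ∈ uIcc a b, u t = v t) →
      ∫ t in a..b, u t = ∫ t in a..b, v t := fun h => integral_congr h
  convert h using 1
  · funext e
    exact hcongr fun t ht => by simp only [Function.comp_apply, hπe t ht]
  · congr 2 <;> exact hcongr fun t ht => by simp only [Function.comp_apply, hπe t ht]

/-- The first variation of a composite functional `H (∫ f₁, …, ∫ fₘ)`. -/
theorem hasStrictFDerivAt_composite_variation {a b : ℝ} (hab : a < b)
    {ι : Type*} [Fintype ι] [DecidableEq ι]
    {f fy fv : ι → ℝ → ℝ → ℝ → ℝ} (hf : ∀ i, IsC1Lagrangian a b (f i) (fy i) (fv i))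
    {H : (ι → ℝ) → ℝ} {H' : ι → (ι → ℝ) → ℝ}
    (hH : ∀ i z, HasDerivAt (fun s => H (Function.update z i s)) (H' i z) (z i))
    (hH' : ∀ i, Continuous (H' i)) {x x' φ₁ φ₂ : ℝ → ℝ}
    (hx : ContinuousOn x (Icc a b)) (hx' : ContinuousOn x' (Icc a b))
    (hφ₁ : Continuous φ₁) (hφ₁0 : ∫ t in a..b, φ₁ t = 0)
    (hφ₂ : Continuous φ₂) (hφ₂0 : ∫ t in a..b, φ₂ t = 0) :
    HasStrictFDerivAt (fun e : ℝ × ℝ => H fun i => ∫ t in a..b,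
        f i t (x t + (e.1 * (∫ τ in a..t, φ₁ τ) + e.2 * (∫ τ in a..t, φ₂ τ)))
          (x' t + (e.1 * φ₁ t + e.2 * φ₂ t)))
      ((ContinuousLinearMap.toSpanSingleton ℝ
          (∫ t in a..b, (∑ i, H' i (fun l => ∫ s in a..b, f l s (x s) (x' s)) *
            integratedEulerLagrange a (fy i) (fv i) x x' t) * φ₁ t)).coprod
        (ContinuousLinearMap.toSpanSingleton ℝ
          (∫ t in a..b, (∑ i, H' i (fun l => ∫ s in a..b, f l s (x s) (x' s)) *
            integratedEulerLagrange a (fy i) (fv i) x x' t) * φ₂ t))) 0 := by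
  have hinner := hasStrictFDerivAt_pi.2 fun i =>
    (hf i).hasStrictFDerivAt_integral_variation hab hx hx' hφ₁ hφ₁0 hφ₂ hφ₂0
  have h := (hasStrictFDerivAt_of_continuous_partials hH hH' _).comp (0 : ℝ × ℝ) hinner
  have hsum : ∀ φ : ℝ → ℝ, Continuous φ → ∀ c : ι → ℝ,
      ∫ t in a..b, (∑ i, c i * integratedEulerLagrange a (fy i) (fv i) x x' t) * φ t
        = ∑ i, c i * ∫ t in a..b, integratedEulerLagrange a (fy i) (fv i) x x' t * φ t := by
    intro φ hφ c
    simp only [Finset.sum_mul, mul_assoc]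
    rw [integral_finsetSum fun i _ => ?_]
    · simp only [integral_const_mul]
    · exact ((((hf i).continuousOn_integratedEulerLagrange hab hx hx').mul
        hφ.continuousOn).intervalIntegrable_of_Icc hab.le).const_mul (c i)
  refine h.congr_fderiv ?_
  rw [hsum φ₁ hφ₁, hsum φ₂ hφ₂]
  ext <;> simp

theorem eventually_supIcc_lt {a b : ℝ} {η₁ η₂ : ℝ → ℝ} (h₁ : Continuous η₁) (h₂ : Continuous η₂)
    {δ : ℝ} (hδ : 0 < δ) :
    ∀ᶠ e : ℝ × ℝ in 𝓝 0, supIcc a b (fun t => e.1 * η₁ t + e.2 * η₂ t) < δ := by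
  obtain ⟨C₁, hC₁⟩ := (isCompact_Icc (a := a) (b := b)).exists_bound_of_continuousOn
    h₁.continuousOn
  obtain ⟨C₂, hC₂⟩ := (isCompact_Icc (a := a) (b := b)).exists_bound_of_continuousOn
    h₂.continuousOn
  have hlim : ∀ᶠ e : ℝ × ℝ in 𝓝 0, |e.1| * |C₁| + |e.2| * |C₂| < δ := by
    have hc : Continuous fun e : ℝ × ℝ => |e.1| * |C₁| + |e.2| * |C₂| := by fun_prop
    exact hc.continuousAt.eventually_lt continuousAt_const (by simpa using hδ)
  filter_upwards [hlim] with e he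
  refine (Real.iSup_le (fun t => ?_) (by positivity)).trans_lt he
  calc |e.1 * η₁ t.1 + e.2 * η₂ t.1| ≤ |e.1| * |η₁ t.1| + |e.2| * |η₂ t.1| := by
        simpa only [abs_mul] using abs_add_le (e.1 * η₁ t.1) (e.2 * η₂ t.1)
    _ ≤ |e.1| * |C₁| + |e.2| * |C₂| := by
        refine add_le_add (mul_le_mul_of_nonneg_left ?_ (abs_nonneg _))
          (mul_le_mul_of_nonneg_left ?_ (abs_nonneg _))
        · exact (hC₁ t.1 t.2).trans (le_abs_self _)
        · exact (hC₂ t.1 t.2).trans (le_abs_self _)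

/-- Necessary optimality condition for the general isoperimetric problem
(specialization of Theorem 6 to the time scale `T = ℝ`):
if `xh` is a normal extremizer (a weak local extremizer that is not an extremal
for the constraint functional `K`), then there exist a Lagrange multiplier `λ`
and a constant `c` such that the isoperimetric Euler–Lagrange equation holds. -/
theorem isoperimetric_optimality
    (a b : ℝ) (hab : a < b) (m p : ℕ) (hm : 1 ≤ m) (hp : 1 ≤ p)
    (xa xb d : ℝ)
    (f fy fv : Fin m → ℝ → ℝ → ℝ → ℝ)
    (g gy gv : Fin p → ℝ → ℝ → ℝ → ℝ)
    (H : (Fin m → ℝ) → ℝ) (H' : Fin m → (Fin m → ℝ) → ℝ)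
    (P : (Fin p → ℝ) → ℝ) (P' : Fin p → (Fin p → ℝ) → ℝ)
    (hf : ∀ i, ContinuousOn (fun q : ℝ × ℝ × ℝ => f i q.1 q.2.1 q.2.2)
      (Icc a b ×ˢ (univ : Set (ℝ × ℝ))))
    (hg : ∀ j, ContinuousOn (fun q : ℝ × ℝ × ℝ => g j q.1 q.2.1 q.2.2)
      (Icc a b ×ˢ (univ : Set (ℝ × ℝ))))
    (hfy : ∀ i, ∀ t ∈ Icc a b, ∀ y v : ℝ,
      HasDerivAt (fun y' => f i t y' v) (fy i t y v) y)
    (hfv : ∀ i, ∀ t ∈ Icc a b, ∀ y v : ℝ,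
      HasDerivAt (fun v' => f i t y v') (fv i t y v) v)
    (hgy : ∀ j, ∀ t ∈ Icc a b, ∀ y v : ℝ,
      HasDerivAt (fun y' => g j t y' v) (gy j t y v) y)
    (hgv : ∀ j, ∀ t ∈ Icc a b, ∀ y v : ℝ,
      HasDerivAt (fun v' => g j t y v') (gv j t y v) v)
    (hfyc : ∀ i, ContinuousOn (fun q : ℝ × ℝ × ℝ => fy i q.1 q.2.1 q.2.2)
      (Icc a b ×ˢ (univ : Set (ℝ × ℝ))))
    (hfvc : ∀ i, ContinuousOn (fun q : ℝ × ℝ × ℝ => fv i q.1 q.2.1 q.2.2)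
      (Icc a b ×ˢ (univ : Set (ℝ × ℝ))))
    (hgyc : ∀ j, ContinuousOn (fun q : ℝ × ℝ × ℝ => gy j q.1 q.2.1 q.2.2)
      (Icc a b ×ˢ (univ : Set (ℝ × ℝ))))
    (hgvc : ∀ j, ContinuousOn (fun q : ℝ × ℝ × ℝ => gv j q.1 q.2.1 q.2.2)
      (Icc a b ×ˢ (univ : Set (ℝ × ℝ))))
    (hH : ∀ i z, HasDerivAt (fun s => H (Function.update z i s)) (H' i z) (z i))
    (hH' : ∀ i, Continuous (H' i))
    (hP : ∀ j z, HasDerivAt (fun s => P (Function.update z j s)) (P' j z) (z j))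
    (hP' : ∀ j, Continuous (P' j))
    (xh xh' : ℝ → ℝ)
    (hxh : ∀ t ∈ Icc a b, HasDerivAt xh (xh' t) t)
    (hxhc : ContinuousOn xh' (Icc a b))
    (hxa : xh a = xa) (hxb : xh b = xb)
    (hK : P (fun j => ∫ t in a..b, g j t (xh t) (xh' t)) = d)
    -- `xh` is a weak local extremizer of `L` among admissible functions
    -- satisfying the isoperimetric constraint `K(x) = d`:
    (hext : ∃ δ > (0:ℝ),
      (∀ x x' : ℝ → ℝ,
        (∀ t ∈ Icc a b, HasDerivAt x (x' t) t) → ContinuousOn x' (Icc a b) →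
        x a = xa → x b = xb →
        P (fun j => ∫ t in a..b, g j t (x t) (x' t)) = d →
        supIcc a b (fun t => x t - xh t) + supIcc a b (fun t => x' t - xh' t) < δ →
        H (fun i => ∫ t in a..b, f i t (xh t) (xh' t))
          ≤ H (fun i => ∫ t in a..b, f i t (x t) (x' t))) ∨
      (∀ x x' : ℝ → ℝ,
        (∀ t ∈ Icc a b, HasDerivAt x (x' t) t) → ContinuousOn x' (Icc a b) →
        x a = xa → x b = xb →
        P (fun j => ∫ t in a..b, g j t (x t) (x' t)) = d →
        supIcc a b (fun t => x t - xh t) + supIcc a b (fun t => x' t - xh' t) < δ →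
        H (fun i => ∫ t in a..b, f i t (x t) (x' t))
          ≤ H (fun i => ∫ t in a..b, f i t (xh t) (xh' t)))) :
    -- normality: `xh` is not an extremal for `K`
    (hnormal : ¬ ∃ k : ℝ, ∀ t ∈ Icc a b,
      ∑ j : Fin p, P' j (fun l => ∫ s in a..b, g l s (xh s) (xh' s)) *
        (gv j t (xh t) (xh' t) - ∫ τ in a..t, gy j τ (xh τ) (xh' τ)) = k) →
    ∃ lam c : ℝ, ∀ t ∈ Icc a b,
      ∑ i : Fin m, H' i (fun l => ∫ s in a..b, f l s (xh s) (xh' s)) *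
        (fv i t (xh t) (xh' t) - ∫ τ in a..t, fy i τ (xh τ) (xh' τ))
      - lam * ∑ j : Fin p, P' j (fun l => ∫ s in a..b, g l s (xh s) (xh' s)) *
        (gv j t (xh t) (xh' t) - ∫ τ in a..t, gy j τ (xh τ) (xh' τ)) = c := by
  intro hnormal
  have hxc : ContinuousOn xh (Icc a b) := fun t ht => (hxh t ht).continuousAt.continuousWithinAt
  have hfL : ∀ i, IsC1Lagrangian a b (f i) (fy i) (fv i) := fun i =>
    ⟨hf i, hfyc i, hfvc i, hfy i, hfv i⟩
  have hgL : ∀ j, IsC1Lagrangian a b (g j) (gy j) (gv j) := fun j =>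
    ⟨hg j, hgyc j, hgvc j, hgy j, hgv j⟩
  set Φ : ℝ → ℝ := fun t => ∑ i, H' i (fun l => ∫ s in a..b, f l s (xh s) (xh' s)) *
    integratedEulerLagrange a (fy i) (fv i) xh xh' t with hΦ
  set Ψ : ℝ → ℝ := fun t => ∑ j, P' j (fun l => ∫ s in a..b, g l s (xh s) (xh' s)) *
    integratedEulerLagrange a (gy j) (gv j) xh xh' t with hΨ
  have hΦc : ContinuousOn Φ (Icc a b) := continuousOn_finsetSum _ fun i _ =>
    continuousOn_const.mul ((hfL i).continuousOn_integratedEulerLagrange hab hxc hxhc)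
  have hΨc : ContinuousOn Ψ (Icc a b) := continuousOn_finsetSum _ fun j _ =>
    continuousOn_const.mul ((hgL j).continuousOn_integratedEulerLagrange hab hxc hxhc)
  have hdep : ∀ φ₁ φ₂ : ℝ → ℝ, Continuous φ₁ → ∫ t in a..b, φ₁ t = 0 →
      Continuous φ₂ → ∫ t in a..b, φ₂ t = 0 →
      (∫ t in a..b, Φ t * φ₁ t) * (∫ t in a..b, Ψ t * φ₂ t)
        = (∫ t in a..b, Φ t * φ₂ t) * (∫ t in a..b, Ψ t * φ₁ t) := by
    intro φ₁ φ₂ hφ₁ hφ₁0 hφ₂ hφ₂0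
    have hL := hasStrictFDerivAt_composite_variation hab hfL hH hH' hxc hxhc hφ₁ hφ₁0 hφ₂ hφ₂0
    have hKd := hasStrictFDerivAt_composite_variation hab hgL hP hP' hxc hxhc hφ₁ hφ₁0 hφ₂ hφ₂0
    have hη : ∀ {φ : ℝ → ℝ}, Continuous φ → ∀ t,
        HasDerivAt (fun t => ∫ τ in a..t, φ τ) (φ t) t := fun hφ t =>
      (hφ.integral_hasStrictDerivAt a t).hasDerivAt
    have hηc : ∀ {φ : ℝ → ℝ}, Continuous φ → Continuous fun t => ∫ τ in a..t, φ τ := fun hφ =>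
      continuous_iff_continuousAt.2 fun t => (hη hφ t).continuousAt
    obtain ⟨δ, hδ, hopt⟩ := hext
    have hsmall : ∀ᶠ e : ℝ × ℝ in 𝓝 0,
        supIcc a b (fun t => xh t + (e.1 * (∫ τ in a..t, φ₁ τ) + e.2 * (∫ τ in a..t, φ₂ τ)) - xh t)
          + supIcc a b (fun t => xh' t + (e.1 * φ₁ t + e.2 * φ₂ t) - xh' t) < δ := by
      filter_upwards [eventually_supIcc_lt (a := a) (b := b) (hηc hφ₁) (hηc hφ₂) (half_pos hδ),
        eventually_supIcc_lt (a := a) (b := b) hφ₁ hφ₂ (half_pos hδ)] with e h1 h2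
      simp only [add_sub_cancel_left]
      linarith
    have hadm : ∀ e : ℝ × ℝ, ∀ t ∈ Icc a b, HasDerivAt
        (fun t => xh t + (e.1 * (∫ τ in a..t, φ₁ τ) + e.2 * (∫ τ in a..t, φ₂ τ)))
        (xh' t + (e.1 * φ₁ t + e.2 * φ₂ t)) t := fun e t ht =>
      (hxh t ht).add (((hη hφ₁ t).const_mul e.1).add ((hη hφ₂ t).const_mul e.2))
    have hadm' : ∀ e : ℝ × ℝ, ContinuousOn (fun t => xh' t + (e.1 * φ₁ t + e.2 * φ₂ t))
        (Icc a b) := fun e =>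
      hxhc.add (by fun_prop : Continuous fun t => e.1 * φ₁ t + e.2 * φ₂ t).continuousOn
    have hextr : IsLocalExtrOn
        (fun e : ℝ × ℝ => H fun i => ∫ t in a..b,
          f i t (xh t + (e.1 * (∫ τ in a..t, φ₁ τ) + e.2 * (∫ τ in a..t, φ₂ τ)))
            (xh' t + (e.1 * φ₁ t + e.2 * φ₂ t)))
        {e : ℝ × ℝ | (fun e : ℝ × ℝ => P fun j => ∫ t in a..b,
          g j t (xh t + (e.1 * (∫ τ in a..t, φ₁ τ) + e.2 * (∫ τ in a..t, φ₂ τ)))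
            (xh' t + (e.1 * φ₁ t + e.2 * φ₂ t))) e = (fun e : ℝ × ℝ => P fun j => ∫ t in a..b,
          g j t (xh t + (e.1 * (∫ τ in a..t, φ₁ τ) + e.2 * (∫ τ in a..t, φ₂ τ)))
            (xh' t + (e.1 * φ₁ t + e.2 * φ₂ t))) 0} 0 := by
      rcases hopt with hmin | hmax
      · left
        filter_upwards [mem_nhdsWithin_of_mem_nhds hsmall, self_mem_nhdsWithin] with e he hKe
        have hKe' := hKe.trans (by simpa using hK)
        simpa using hmin _ _ (hadm e) (hadm' e) (by simp [hxa]) (by simp [hxb, hφ₁0, hφ₂0])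
          hKe' he
      · right
        filter_upwards [mem_nhdsWithin_of_mem_nhds hsmall, self_mem_nhdsWithin] with e he hKe
        have hKe' := hKe.trans (by simpa using hK)
        simpa using hmax _ _ (hadm e) (hadm' e) (by simp [hxa]) (by simp [hxb, hφ₁0, hφ₂0])
          hKe' he
    obtain ⟨α, β, hαβ, hlin⟩ := hextr.exists_multipliers_of_hasStrictFDerivAt_1d hKd hL
    have h1 : α * (∫ t in a..b, Ψ t * φ₁ t) + β * (∫ t in a..b, Φ t * φ₁ t) = 0 := by
      simpa using DFunLike.congr_fun hlin ((1, 0) : ℝ × ℝ)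
    have h2 : α * (∫ t in a..b, Ψ t * φ₂ t) + β * (∫ t in a..b, Φ t * φ₂ t) = 0 := by
      simpa using DFunLike.congr_fun hlin ((0, 1) : ℝ × ℝ)
    by_cases hβ : β = 0
    · have hα : α ≠ 0 := fun hα => hαβ (by simp [hα, hβ])
      apply mul_left_cancel₀ hα
      linear_combination (∫ t in a..b, Φ t * φ₁ t) * h2 - (∫ t in a..b, Φ t * φ₂ t) * h1
    · apply mul_left_cancel₀ hβ
      linear_combination (∫ t in a..b, Ψ t * φ₂ t) * h1 - (∫ t in a..b, Ψ t * φ₁ t) * h2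
  obtain ⟨φ₂, hφ₂, hφ₂0, hne⟩ : ∃ φ₂ : ℝ → ℝ, Continuous φ₂ ∧ ∫ t in a..b, φ₂ t = 0 ∧
      ∫ t in a..b, Ψ t * φ₂ t ≠ 0 := by
    by_contra! hcon
    exact hnormal (exists_eq_const_of_integral_mul_eq_zero hab hΨc hcon)
  refine ⟨(∫ t in a..b, Φ t * φ₂ t) / ∫ t in a..b, Ψ t * φ₂ t, ?_⟩
  set lam := (∫ t in a..b, Φ t * φ₂ t) / ∫ t in a..b, Ψ t * φ₂ t with hlam
  refine exists_eq_const_of_integral_mul_eq_zero (Φ := fun t => Φ t - lam * Ψ t) hab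
    (hΦc.sub (continuousOn_const.mul hΨc)) fun φ hφ hφ0 => ?_
  simp only [sub_mul, mul_assoc]
  have hΦφ : IntervalIntegrable (fun t => Φ t * φ t) MeasureTheory.volume a b :=
    (hΦc.mul hφ.continuousOn).intervalIntegrable_of_Icc hab.le
  have hΨφ : IntervalIntegrable (fun t => Ψ t * φ t) MeasureTheory.volume a b :=
    (hΨc.mul hφ.continuousOn).intervalIntegrable_of_Icc hab.le
  rw [integral_sub hΦφ (hΨφ.const_mul lam),
    integral_const_mul, hlam, div_mul_eq_mul_div, ← hdep φ φ₂ hφ hφ0 hφ₂ hφ₂0,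
    mul_div_cancel_right₀ _ hne, sub_self]
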